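/- arXiv:2308.08209 — 7 statements merged into one kernel-verified Lean document; each statement's English description precedes it below -/
import Mathlib

section
/- Let 𝒯 be an associative conformal algebra, 𝒰 a conformal 𝒯-bimodule, and H a Hochschild 2-cocycle. A ℂ[∂]-linear map ℛ : 𝒰 → 𝒯 is a conformal H-twisted Rota-Baxter operator if and only if its graph Gr(ℛ) = {(ℛ(u), u) | u ∈ 𝒰} is a subalgebra of the H-twisted semidirect product 𝒯 ⋉^H 𝒰. -/
/-!
We model an associative conformal algebra over `ℂ` by a `ℂ`-module `T` together with
the action of `∂` (written `D`) and, for every `λ ∈ ℂ`, a `ℂ`-bilinear `λ`-product;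
the λ-product is modeled by its evaluations at the complex values of `λ`
(conformal sesquilinearity and conformal associativity are imposed).
-/

structure ConformalAlg (T : Type*) [AddCommGroup T] [Module ℂ T] where
  D : T → T
  D_add : ∀ p q, D (p + q) = D p + D q
  D_smul : ∀ (c : ℂ) (p : T), D (c • p) = c • D p
  mul : ℂ → T → T → T
  mul_add_left : ∀ (l : ℂ) (p q r : T), mul l (p + q) r = mul l p r + mul l q r
  mul_add_right : ∀ (l : ℂ) (p q r : T), mul l p (q + r) = mul l p q + mul l p r
  mul_smul_left : ∀ (l c : ℂ) (p q : T), mul l (c • p) q = c • mul l p q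
  mul_smul_right : ∀ (l c : ℂ) (p q : T), mul l p (c • q) = c • mul l p q
  sesq_left : ∀ (l : ℂ) (p q : T), mul l (D p) q = (-l) • mul l p q
  sesq_right : ∀ (l : ℂ) (p q : T), mul l p (D q) = D (mul l p q) + l • mul l p q
  conf_assoc : ∀ (l m : ℂ) (p q r : T), mul (l + m) (mul l p q) r = mul l p (mul m q r)

/-- A conformal bimodule over an associative conformal algebra. -/
structure ConformalBimod {T : Type*} [AddCommGroup T] [Module ℂ T]
    (A : ConformalAlg T) (U : Type*) [AddCommGroup U] [Module ℂ U] where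
  D : U → U
  D_add : ∀ u v, D (u + v) = D u + D v
  D_smul : ∀ (c : ℂ) (u : U), D (c • u) = c • D u
  lact : ℂ → T → U → U
  ract : ℂ → U → T → U
  lact_add_left : ∀ (l : ℂ) (p q : T) (u : U), lact l (p + q) u = lact l p u + lact l q u
  lact_add_right : ∀ (l : ℂ) (p : T) (u v : U), lact l p (u + v) = lact l p u + lact l p v
  lact_smul_left : ∀ (l c : ℂ) (p : T) (u : U), lact l (c • p) u = c • lact l p u
  lact_smul_right : ∀ (l c : ℂ) (p : T) (u : U), lact l p (c • u) = c • lact l p u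
  ract_add_left : ∀ (l : ℂ) (u v : U) (p : T), ract l (u + v) p = ract l u p + ract l v p
  ract_add_right : ∀ (l : ℂ) (u : U) (p q : T), ract l u (p + q) = ract l u p + ract l u q
  ract_smul_left : ∀ (l c : ℂ) (u : U) (p : T), ract l (c • u) p = c • ract l u p
  ract_smul_right : ∀ (l c : ℂ) (u : U) (p : T), ract l u (c • p) = c • ract l u p
  lact_sesq_left : ∀ (l : ℂ) (p : T) (u : U), lact l (A.D p) u = (-l) • lact l p u
  lact_sesq_right : ∀ (l : ℂ) (p : T) (u : U), lact l p (D u) = D (lact l p u) + l • lact l p u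
  ract_sesq_left : ∀ (l : ℂ) (u : U) (p : T), ract l (D u) p = (-l) • ract l u p
  ract_sesq_right : ∀ (l : ℂ) (u : U) (p : T), ract l u (A.D p) = D (ract l u p) + l • ract l u p
  comp_lr : ∀ (l m : ℂ) (p : T) (u : U) (q : T),
    ract (l + m) (lact l p u) q = lact l p (ract m u q)
  comp_rr : ∀ (l m : ℂ) (u : U) (p q : T),
    ract (l + m) (ract l u p) q = ract l u (A.mul m p q)
  comp_ll : ∀ (l m : ℂ) (p q : T) (u : U),
    lact (l + m) (A.mul l p q) u = lact l p (lact m q u)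

/-- A conformal Hochschild 2-cocycle of `T` with coefficients in the conformal bimodule `U`. -/
structure Hochschild2Cocycle {T : Type*} [AddCommGroup T] [Module ℂ T]
    {U : Type*} [AddCommGroup U] [Module ℂ U]
    (A : ConformalAlg T) (M : ConformalBimod A U) where
  H : ℂ → T → T → U
  add_left : ∀ (l : ℂ) (p q r : T), H l (p + q) r = H l p r + H l q r
  add_right : ∀ (l : ℂ) (p q r : T), H l p (q + r) = H l p q + H l p r
  smul_left : ∀ (l c : ℂ) (p q : T), H l (c • p) q = c • H l p q
  smul_right : ∀ (l c : ℂ) (p q : T), H l p (c • q) = c • H l p q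
  sesq_left : ∀ (l : ℂ) (p q : T), H l (A.D p) q = (-l) • H l p q
  sesq_right : ∀ (l : ℂ) (p q : T), H l p (A.D q) = M.D (H l p q) + l • H l p q
  cocycle : ∀ (l1 l2 : ℂ) (p1 p2 p3 : T),
    M.lact l1 p1 (H l2 p2 p3) - H (l1 + l2) (A.mul l1 p1 p2) p3
      + H l1 p1 (A.mul l2 p2 p3) - M.ract (l1 + l2) (H l1 p1 p2) p3 = 0

variable {T : Type*} [AddCommGroup T] [Module ℂ T]
variable {U : Type*} [AddCommGroup U] [Module ℂ U]

/-- `R : U → T` is a `ℂ[∂]`-linear map. -/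
def IsCDLinear (A : ConformalAlg T) (M : ConformalBimod A U) (R : U → T) : Prop :=
  (∀ u v, R (u + v) = R u + R v) ∧ (∀ (c : ℂ) (u : U), R (c • u) = c • R u) ∧
    (∀ u, R (M.D u) = A.D (R u))

/-- A conformal `H`-twisted Rota-Baxter operator: a `ℂ[∂]`-linear map `R : U → T` with
`R(u) ₗ R(v) = R (u ₗ R(v) + R(u) ₗ v + H ₗ (R u) (R v))`. -/
def IsHTRB (A : ConformalAlg T) (M : ConformalBimod A U)
    (H : ℂ → T → T → U) (R : U → T) : Prop :=
  IsCDLinear A M R ∧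
    ∀ (l : ℂ) (u v : U),
      A.mul l (R u) (R v) = R (M.ract l u (R v) + M.lact l (R u) v + H l (R u) (R v))

/-- The λ-product of the `K`-twisted semidirect product `T ⋉^K U`. -/
def sdMul (A : ConformalAlg T) (M : ConformalBimod A U) (K : ℂ → T → T → U) :
    ℂ → T × U → T × U → T × U :=
  fun l x y => (A.mul l x.1 y.1, M.lact l x.1 y.2 + M.ract l x.2 y.1 + K l x.1 y.1)

/-- The `∂`-action on the semidirect product `T ⋉ U`. -/
def sdD (A : ConformalAlg T) (M : ConformalBimod A U) : T × U → T × U :=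
  fun x => (A.D x.1, M.D x.2)

/-- `S` is a subalgebra: a `ℂ[∂]`-submodule closed under all the λ-products. -/
def IsSubalg (D' : T × U → T × U) (mul' : ℂ → T × U → T × U → T × U)
    (S : Set (T × U)) : Prop :=
  (∀ x ∈ S, ∀ y ∈ S, x + y ∈ S) ∧ (∀ (c : ℂ), ∀ x ∈ S, c • x ∈ S) ∧
    (∀ x ∈ S, D' x ∈ S) ∧ (∀ (l : ℂ), ∀ x ∈ S, ∀ y ∈ S, mul' l x y ∈ S)

/-- A `ℂ[∂]`-linear map `R : U → T` is a conformal `H`-twisted Rota-Baxter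
operator iff its graph `{(R u, u) | u ∈ U}` is a subalgebra of `T ⋉^H U`. -/
theorem graph_subalgebra_iff_HTRB
    (A : ConformalAlg T) (M : ConformalBimod A U) (Hc : Hochschild2Cocycle A M)
    (R : U → T) (hR : IsCDLinear A M R) :
    IsHTRB A M Hc.H R ↔
      IsSubalg (sdD A M) (sdMul A M Hc.H) (Set.range fun u : U => ((R u : T), u)) := by
  constructor
  · rintro ⟨-, hmul⟩
    obtain ⟨hadd, hsmul, hD⟩ := hR
    refine ⟨?_, ?_, ?_, ?_⟩
    · rintro _ ⟨u, rfl⟩ _ ⟨v, rfl⟩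
      exact ⟨u + v, Prod.ext (hadd u v) rfl⟩
    · rintro c _ ⟨u, rfl⟩
      exact ⟨c • u, Prod.ext (hsmul c u) rfl⟩
    · rintro _ ⟨u, rfl⟩
      exact ⟨M.D u, Prod.ext (hD u) rfl⟩
    · rintro l _ ⟨u, rfl⟩ _ ⟨v, rfl⟩
      refine ⟨M.lact l (R u) v + M.ract l u (R v) + Hc.H l (R u) (R v), Prod.ext ?_ rfl⟩
      simp only [sdMul, hmul l u v, add_comm (M.lact l (R u) v)]
  · rintro ⟨-, -, -, hmul⟩
    refine ⟨hR, fun l u v => ?_⟩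
    obtain ⟨w, hw⟩ := hmul l _ ⟨u, rfl⟩ _ ⟨v, rfl⟩
    obtain ⟨hfst, hsnd⟩ := Prod.mk.inj hw
    rw [add_comm (M.ract l u (R v)), ← hsnd, hfst]
end

section
/- Let 𝒯 be an associative conformal algebra, 𝒰 a conformal 𝒯-bimodule, and h : 𝒯 → 𝒰 an invertible ℂ[∂]-linear map (a Hochschild 1-cochain). Then ℛ = h^{−1} : 𝒰 → 𝒯 is a conformal H-twisted Rota-Baxter operator for H = −δ_Hoch h, where (δ_Hoch h)_λ(p,q) = p_λ h(q) − h(p_λ q) + h(p)_λ q. -/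
variable {T : Type*} [AddCommGroup T] [Module ℂ T]
variable {U : Type*} [AddCommGroup U] [Module ℂ U]

/-- If `h : T → U` is an invertible `ℂ[∂]`-linear Hochschild 1-cochain
(with inverse `R`), then `R = h⁻¹` is a conformal `H`-twisted Rota-Baxter operator for
`H = -δ_Hoch h`, where `(δ_Hoch h) ₗ (p,q) = p ₗ h(q) - h(p ₗ q) + h(p) ₗ q`. -/
theorem inverse_of_invertible_cochain_is_HTRB
    (A : ConformalAlg T) (M : ConformalBimod A U)
    (h : T → U)
    (hadd : ∀ p q, h (p + q) = h p + h q)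
    (hsmul : ∀ (c : ℂ) (p : T), h (c • p) = c • h p)
    (hD : ∀ p, h (A.D p) = M.D (h p))
    (R : U → T) (hinv1 : ∀ p, R (h p) = p) (hinv2 : ∀ u, h (R u) = u) :
    IsHTRB A M
      (fun l p q => -(M.lact l p (h q) - h (A.mul l p q) + M.ract l (h p) q)) R := by
  have hinj : Function.Injective h := Function.LeftInverse.injective hinv1
  refine ⟨⟨fun u v => hinj ?_, fun c u => hinj ?_, fun u => hinj ?_⟩, fun l u v => hinj ?_⟩
  · rw [hadd, hinv2, hinv2, hinv2]
  · rw [hsmul, hinv2, hinv2]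
  · rw [hD, hinv2, hinv2]
  · simp only [hinv2]
    abel
end

section
/- Let 𝒯 be an associative conformal algebra, 𝒰 a conformal 𝒯-bimodule, H a Hochschild 2-cocycle, and ℛ : 𝒰 → 𝒯 a conformal H-twisted Rota-Baxter operator. Then 𝒰 carries an associative conformal algebra structure with λ-product u *_λ v = u_λ ℛ(v) + ℛ(u)_λ v + H_λ(ℛ(u), ℛ(v)). -/
variable {T : Type*} [AddCommGroup T] [Module ℂ T]
variable {U : Type*} [AddCommGroup U] [Module ℂ U]

/-- If `R : U → T` is a conformal `H`-twisted Rota-Baxter operator, then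
`U` carries an associative conformal algebra structure with the λ-product
`u *ₗ v = u ₗ R(v) + R(u) ₗ v + H ₗ (R u, R v)`. -/
theorem induced_conformal_algebra_on_bimodule
    (A : ConformalAlg T) (M : ConformalBimod A U) (Hc : Hochschild2Cocycle A M)
    (R : U → T) (hR : IsHTRB A M Hc.H R) :
    ∃ S : ConformalAlg U,
      S.D = M.D ∧
      S.mul = fun (l : ℂ) (u v : U) =>
        M.ract l u (R v) + M.lact l (R u) v + Hc.H l (R u) (R v) := by
  obtain ⟨⟨hadd, hsmul, hD⟩, hRB⟩ := hR
  refine ⟨{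
    D := M.D
    D_add := M.D_add
    D_smul := M.D_smul
    mul := fun l u v => M.ract l u (R v) + M.lact l (R u) v + Hc.H l (R u) (R v)
    mul_add_left := fun l p q r => ?_
    mul_add_right := fun l p q r => ?_
    mul_smul_left := fun l c p q => ?_
    mul_smul_right := fun l c p q => ?_
    sesq_left := fun l p q => ?_
    sesq_right := fun l p q => ?_
    conf_assoc := fun l m p q r => ?_ }, rfl, rfl⟩
  · simp only [hadd, M.ract_add_left, M.lact_add_left, Hc.add_left]
    abel
  · simp only [hadd, M.ract_add_right, M.lact_add_right, Hc.add_right]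
    abel
  · simp only [hsmul, M.ract_smul_left, M.lact_smul_left, Hc.smul_left, smul_add]
  · simp only [hsmul, M.ract_smul_right, M.lact_smul_right, Hc.smul_right, smul_add]
  · simp only [hD, M.ract_sesq_left, M.lact_sesq_left, Hc.sesq_left, smul_add]
  · simp only [hD, M.ract_sesq_right, M.lact_sesq_right, Hc.sesq_right, smul_add, M.D_add]
    abel
  · simp only [← hRB]
    simp only [M.ract_add_left, M.lact_add_right, M.comp_lr, M.comp_rr, M.comp_ll]
    rw [← sub_eq_zero, ← neg_eq_zero, ← Hc.cocycle l m (R p) (R q) (R r)]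
    abel
end

section
/- Let ℛ : 𝒰 → 𝒯 be a conformal H-twisted Rota-Baxter operator and h : 𝒯 → 𝒰 any ℂ[∂]-linear Hochschild 1-cochain. Then the set Φ_h(Gr(ℛ)) = {(ℛ(u), u − h(ℛ(u))) | u ∈ 𝒰} is a subalgebra of the (H + δ_Hoch h)-twisted semidirect product 𝒯 ⋉^{H+δ_Hoch h} 𝒰, where (δ_Hoch h)_λ(p,q) = p_λ h(q) − h(p_λ q) + h(p)_λ q. -/
variable {T : Type*} [AddCommGroup T] [Module ℂ T]
variable {U : Type*} [AddCommGroup U] [Module ℂ U]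

/-- The conformal Hochschild differential of a 1-cochain `h : T → U`. -/
def delta1 (A : ConformalAlg T) (M : ConformalBimod A U) (h : T → U) : ℂ → T → T → U :=
  fun l p q => M.lact l p (h q) - h (A.mul l p q) + M.ract l (h p) q

/-- If `R` is a conformal `H`-twisted Rota-Baxter operator and `h : T → U`
any `ℂ[∂]`-linear Hochschild 1-cochain, then
`Φ_h(Gr R) = {(R u, u - h (R u)) | u ∈ U}` is a subalgebra of `T ⋉^{H + δ_Hoch h} U`. -/
theorem deformed_graph_subalgebra
    (A : ConformalAlg T) (M : ConformalBimod A U) (Hc : Hochschild2Cocycle A M)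
    (R : U → T) (hR : IsHTRB A M Hc.H R)
    (h : T → U)
    (hadd : ∀ p q, h (p + q) = h p + h q)
    (hsmul : ∀ (c : ℂ) (p : T), h (c • p) = c • h p)
    (hD : ∀ p, h (A.D p) = M.D (h p)) :
    IsSubalg (sdD A M) (sdMul A M (fun l p q => Hc.H l p q + delta1 A M h l p q))
      (Set.range fun u : U => ((R u : T), u - h (R u))) := by
  obtain ⟨⟨Radd, Rsmul, RD⟩, hRB⟩ := hR
  have M_D_sub (u v : U) : M.D (u - v) = M.D u - M.D v := by
    rw [eq_sub_iff_add_eq, ← M.D_add, sub_add_cancel]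
  have lact_sub (l : ℂ) (p : T) (u v : U) :
      M.lact l p (u - v) = M.lact l p u - M.lact l p v := by
    rw [eq_sub_iff_add_eq, ← M.lact_add_right, sub_add_cancel]
  have ract_sub (l : ℂ) (u v : U) (p : T) :
      M.ract l (u - v) p = M.ract l u p - M.ract l v p := by
    rw [eq_sub_iff_add_eq, ← M.ract_add_left, sub_add_cancel]
  refine ⟨?_, ?_, ?_, ?_⟩
  · rintro _ ⟨u, rfl⟩ _ ⟨v, rfl⟩
    refine ⟨u + v, Prod.ext (Radd u v) ?_⟩
    simp only [Radd, hadd, Prod.snd_add]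
    abel
  · rintro c _ ⟨u, rfl⟩
    refine ⟨c • u, Prod.ext (Rsmul c u) ?_⟩
    simp only [Rsmul, hsmul, Prod.smul_snd, smul_sub]
  · rintro _ ⟨u, rfl⟩
    refine ⟨M.D u, Prod.ext (RD u) ?_⟩
    simp only [sdD, RD, hD, M_D_sub]
  · rintro l _ ⟨u, rfl⟩ _ ⟨v, rfl⟩
    refine ⟨M.ract l u (R v) + M.lact l (R u) v + Hc.H l (R u) (R v),
      Prod.ext (hRB l u v).symm ?_⟩
    simp only [sdMul, delta1, ← hRB, lact_sub, ract_sub]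
    abel
end

section
/- Let ℛ : 𝒰 → 𝒯 be a conformal H-twisted Rota-Baxter operator and h′ : 𝒯 → 𝒰 a ℂ[∂]-linear Hochschild 1-cocycle, i.e., p_λ h′(q) − h′(p_λ q) + h′(p)_λ q = 0 for all p,q ∈ 𝒯. Then the set ξ_{h′}(Gr(ℛ)) = {(ℛ(u), u + h′(ℛ(u))) | u ∈ 𝒰} is a subalgebra of the H-twisted semidirect product 𝒯 ⋉^H 𝒰. -/
variable {T : Type*} [AddCommGroup T] [Module ℂ T]
variable {U : Type*} [AddCommGroup U] [Module ℂ U]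

/-- If `R` is a conformal `H`-twisted Rota-Baxter operator and `h'` a
`ℂ[∂]`-linear Hochschild 1-cocycle, then
`ξ_{h'}(Gr R) = {(R u, u + h' (R u)) | u ∈ U}` is a subalgebra of `T ⋉^H U`. -/
theorem perturbed_graph_subalgebra
    (A : ConformalAlg T) (M : ConformalBimod A U) (Hc : Hochschild2Cocycle A M)
    (R : U → T) (hR : IsHTRB A M Hc.H R)
    (h' : T → U)
    (hadd : ∀ p q, h' (p + q) = h' p + h' q)
    (hsmul : ∀ (c : ℂ) (p : T), h' (c • p) = c • h' p)
    (hD : ∀ p, h' (A.D p) = M.D (h' p))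
    (hcoc : ∀ (l : ℂ) (p q : T),
      M.lact l p (h' q) - h' (A.mul l p q) + M.ract l (h' p) q = 0) :
    IsSubalg (sdD A M) (sdMul A M Hc.H)
      (Set.range fun u : U => ((R u : T), u + h' (R u))) := by
  obtain ⟨⟨R_add, R_smul, R_D⟩, hTRB⟩ := hR
  refine ⟨?_, ?_, ?_, ?_⟩
  · rintro _ ⟨u, rfl⟩ _ ⟨v, rfl⟩
    refine ⟨u + v, Prod.ext (R_add u v) ?_⟩
    simp only [Prod.snd_add, R_add, hadd]
    abel
  · rintro c _ ⟨u, rfl⟩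
    refine ⟨c • u, Prod.ext (R_smul c u) ?_⟩
    simp only [Prod.smul_snd, R_smul, hsmul, smul_add]
  · rintro _ ⟨u, rfl⟩
    refine ⟨M.D u, Prod.ext (R_D u) ?_⟩
    simp only [sdD, R_D, hD, M.D_add]
  · rintro l _ ⟨u, rfl⟩ _ ⟨v, rfl⟩
    refine ⟨M.ract l u (R v) + M.lact l (R u) v + Hc.H l (R u) (R v),
      Prod.ext (hTRB l u v).symm ?_⟩
    have hmul : h' (A.mul l (R u) (R v)) =
        M.lact l (R u) (h' (R v)) + M.ract l (h' (R u)) (R v) := by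
      rw [eq_comm, ← sub_eq_zero, ← hcoc l (R u) (R v)]
      abel
    simp only [sdMul, ← hTRB, hmul, M.lact_add_right, M.ract_add_left]
    abel
end

section
/- Let ℛ : 𝒰 → 𝒯 be a conformal H-twisted Rota-Baxter operator and h′ : 𝒯 → 𝒰 a ℂ[∂]-linear Hochschild 1-cocycle (p_λ h′(q) − h′(p_λ q) + h′(p)_λ q = 0) such that the map id_𝒰 + h′∘ℛ : 𝒰 → 𝒰 is bijective. Then ℛ_{h′} := ℛ ∘ (id_𝒰 + h′∘ℛ)^{−1} is again a conformal H-twisted Rota-Baxter operator. -/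
variable {T : Type*} [AddCommGroup T] [Module ℂ T]
variable {U : Type*} [AddCommGroup U] [Module ℂ U]

/-- If `R` is a conformal `H`-twisted Rota-Baxter operator and `h'` an
`R`-admissible `ℂ[∂]`-linear Hochschild 1-cocycle, i.e. `id + h' ∘ R` is bijective
(with two-sided inverse `g`), then `R_{h'} = R ∘ (id + h' ∘ R)⁻¹ = R ∘ g` is again a
conformal `H`-twisted Rota-Baxter operator. -/
theorem admissible_cocycle_twist_is_HTRB
    (A : ConformalAlg T) (M : ConformalBimod A U) (Hc : Hochschild2Cocycle A M)
    (R : U → T) (hR : IsHTRB A M Hc.H R)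
    (h' : T → U)
    (hadd : ∀ p q, h' (p + q) = h' p + h' q)
    (hsmul : ∀ (c : ℂ) (p : T), h' (c • p) = c • h' p)
    (hD : ∀ p, h' (A.D p) = M.D (h' p))
    (hcoc : ∀ (l : ℂ) (p q : T),
      M.lact l p (h' q) - h' (A.mul l p q) + M.ract l (h' p) q = 0)
    (g : U → U)
    (hg1 : ∀ u, g (u + h' (R u)) = u)
    (hg2 : ∀ u, g u + h' (R (g u)) = u) :
    IsHTRB A M Hc.H (fun u => R (g u)) := by
  obtain ⟨⟨Radd, Rsmul, RD⟩, Rmul⟩ := hR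
  have g_eq {w u : U} (h : w + h' (R w) = u) : g u = w := h ▸ hg1 w
  refine ⟨⟨fun u v => ?_, fun c u => ?_, fun u => ?_⟩, fun l u v => ?_⟩
  · have h : g (u + v) = g u + g v := g_eq <| by
      rw [Radd, hadd, add_add_add_comm, hg2, hg2]
    simp only [h, Radd]
  · have h : g (c • u) = c • g u := g_eq <| by
      rw [Rsmul, hsmul, ← smul_add, hg2]
    simp only [h, Rsmul]
  · have h : g (M.D u) = M.D (g u) := g_eq <| by
      rw [RD, hD, ← M.D_add, hg2]
    simp only [h, RD]
  · have h : g (M.ract l u (R (g v)) + M.lact l (R (g u)) v + Hc.H l (R (g u)) (R (g v))) =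
        M.ract l (g u) (R (g v)) + M.lact l (R (g u)) (g v)
          + Hc.H l (R (g u)) (R (g v)) := g_eq <| by
      have hr := M.ract_add_left l (g u) (h' (R (g u))) (R (g v))
      have hl := M.lact_add_right l (R (g u)) (g v) (h' (R (g v)))
      rw [hg2] at hr hl
      have hc : h' (A.mul l (R (g u)) (R (g v))) =
          M.lact l (R (g u)) (h' (R (g v))) + M.ract l (h' (R (g u))) (R (g v)) := by
        rw [eq_comm, ← sub_eq_zero, ← hcoc l (R (g u)) (R (g v))]
        abel
      rw [← Rmul, hc, hr, hl]
      abel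
    simp only [h, Rmul]
end

section
/- Let ℛ : 𝒰 → 𝒯 be a conformal H-twisted Rota-Baxter operator, h′ an ℛ-admissible Hochschild 1-cocycle (i.e., p_λ h′(q) − h′(p_λ q) + h′(p)_λ q = 0 and id_𝒰 + h′∘ℛ is bijective), and ℛ_{h′} = ℛ(id + h′∘ℛ)^{−1} the resulting conformal H-TRB operator. Then the map id_𝒰 + h′∘ℛ is an isomorphism of associative conformal algebras from (𝒰, *_λ), with u *_λ v = u_λ ℛ(v) + ℛ(u)_λ v + H_λ(ℛ(u),ℛ(v)), onto (𝒰, *_λ^{h′}), with u *_λ^{h′} v = u_λ ℛ_{h′}(v) + ℛ_{h′}(u)_λ v + H_λ(ℛ_{h′}(u),ℛ_{h′}(v)); explicitly, (id + h′∘ℛ)(u *_λ v) = (id + h′∘ℛ)(u) *_λ^{h′} (id + h′∘ℛ)(v). -/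
variable {T : Type*} [AddCommGroup T] [Module ℂ T]
variable {U : Type*} [AddCommGroup U] [Module ℂ U]

/-- For an `R`-admissible 1-cocycle `h'` (with `g` the two-sided inverse of
`id + h' ∘ R`, so that `R_{h'} = R ∘ g`), the map `id + h' ∘ R` is an isomorphism of
associative conformal algebras from `(U, *ₗ)` onto `(U, *ₗ^{h'})`; explicitly it is a
bijective `ℂ[∂]`-linear map with
`(id + h'∘R)(u *ₗ v) = (id + h'∘R)(u) *ₗ^{h'} (id + h'∘R)(v)`. -/
theorem admissible_twist_gives_isomorphic_structures
    (A : ConformalAlg T) (M : ConformalBimod A U) (Hc : Hochschild2Cocycle A M)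
    (R : U → T) (hR : IsHTRB A M Hc.H R)
    (h' : T → U)
    (hadd : ∀ p q, h' (p + q) = h' p + h' q)
    (hsmul : ∀ (c : ℂ) (p : T), h' (c • p) = c • h' p)
    (hD : ∀ p, h' (A.D p) = M.D (h' p))
    (hcoc : ∀ (l : ℂ) (p q : T),
      M.lact l p (h' q) - h' (A.mul l p q) + M.ract l (h' p) q = 0)
    (g : U → U)
    (hg1 : ∀ u, g (u + h' (R u)) = u)
    (hg2 : ∀ u, g u + h' (R (g u)) = u) :
    Function.Bijective (fun u : U => u + h' (R u)) ∧
    (∀ (c : ℂ) (u v : U),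
      (fun u : U => u + h' (R u)) (c • u + v)
        = c • (u + h' (R u)) + (v + h' (R v))) ∧
    (∀ u : U, (fun u : U => u + h' (R u)) (M.D u) = M.D (u + h' (R u))) ∧
    (∀ (l : ℂ) (u v : U),
      (fun u : U => u + h' (R u))
          (M.ract l u (R v) + M.lact l (R u) v + Hc.H l (R u) (R v))
        = M.ract l (u + h' (R u)) (R (g (v + h' (R v))))
          + M.lact l (R (g (u + h' (R u)))) (v + h' (R v))
          + Hc.H l (R (g (u + h' (R u)))) (R (g (v + h' (R v))))) := by
  obtain ⟨⟨R_add, R_smul, R_D⟩, R_mul⟩ := hR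
  have h_mul (l : ℂ) (p q : T) :
      h' (A.mul l p q) = M.lact l p (h' q) + M.ract l (h' p) q := by
    rw [eq_comm, ← sub_eq_zero, ← hcoc l p q]
    abel
  refine ⟨Function.bijective_iff_has_inverse.mpr ⟨g, hg1, hg2⟩, fun c u v ↦ ?_,
    fun u ↦ ?_, fun l u v ↦ ?_⟩
  · simp only [R_add, R_smul, hadd, hsmul, smul_add]
    abel
  · simp only [R_D, hD, M.D_add]
  · simp only [hg1, ← R_mul, h_mul, M.ract_add_left, M.lact_add_right]
    abel
end
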